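/- Let d ≥ 2 be a rare factor order (i.e., d belongs to no f_i), and let J be an invariant-factor count function for d. Then lim_{n→∞} (1/n)·#{1 ≤ m ≤ n : J(m) > 0} = 0; in other words, the set of integers m for which ℤ_d occurs as an invariant factor of (ℤ/mℤ)^× has natural density 0. -/

import Mathlib

open MeasureTheory ProbabilityTheory Filter

noncomputable section

/-- A key encoding the lexicographic order on pairs `(φ(q), q)`; this is a valid
encoding on prime powers since every prime power satisfies `q ≤ 2 * φ(q)`. -/
def ppKey (q : ℕ) : ℕ := 2 * Nat.totient q ^ 2 + q

/-- The `n`-th smallest key of a prime power (0-indexed). -/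
def ppNthKey (n : ℕ) : ℕ := Nat.nth (fun k => ∃ q : ℕ, IsPrimePow q ∧ ppKey q = k) n

/-- The total φ-sequence `q̃_i` (1-indexed): the enumeration of all prime powers
ordered by nondecreasing totient, with ties broken by increasing size. -/
def qt (i : ℕ) : ℕ := sInf {q : ℕ | IsPrimePow q ∧ ppKey q = ppNthKey (i - 1)}

/-- `lcm(q̃_1, …, q̃_i)`. -/
def Lseq (i : ℕ) : ℕ := (Finset.Icc 1 i).lcm qt

/-- The universal factor order set `f_i`. -/
def UFO (i : ℕ) : Set ℕ :=
  if Nat.totient (qt i) < Nat.totient (qt (i + 1)) then {Lseq i}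
  else {Lseq i, Nat.lcm (Lseq (i - 1)) (qt (i + 1))}

/-- `φ(q̃_i)` as a real number. -/
def phiQ (i : ℕ) : ℝ := (Nat.totient (qt i) : ℝ)

/-- `μ_i = 1/φ(q̃_i) − 1/φ(q̃_{i+1})`. -/
def muSeq (i : ℕ) : ℝ := 1 / phiQ i - 1 / phiQ (i + 1)

/-- `σ_i = (1/φ(q̃_i) + 1/φ(q̃_{i+1}) − 2/(φ(q̃_i)·φ(q̃_{i+1})))^{1/2}`. -/
def sigSeq (i : ℕ) : ℝ :=
  Real.sqrt (1 / phiQ i + 1 / phiQ (i + 1) - 2 / (phiQ i * phiQ (i + 1)))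

/-- `σ_{i;a,b} = (φ(q̃_i)^{−a} + φ(q̃_{i+1})^{−b} − 2/(φ(q̃_i)·φ(q̃_{i+1})))^{1/2}`. -/
def sigAB (i a b : ℕ) : ℝ :=
  Real.sqrt (1 / phiQ i ^ a + 1 / phiQ (i + 1) ^ b - 2 / (phiQ i * phiQ (i + 1)))

/-- `ν_j = (φ(q̃_j)^{−1}·(1 − φ(q̃_j)^{−1}))^{1/2}`. -/
def nuSeq (j : ℕ) : ℝ := Real.sqrt (1 / phiQ j * (1 - 1 / phiQ j))

/-- `J` is an invariant-factor count function for `d`: whenever `(ℤ/mℤ)ˣ` is isomorphic to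
a direct product of cyclic groups `ℤ/λ_1 × ⋯ × ℤ/λ_K` with `1 < λ_1 ∣ λ_2 ∣ ⋯ ∣ λ_K`,
`J m` is the number of indices `j` with `λ_j = d`. -/
def IsInvCount (d : ℕ) (J : ℕ → ℕ) : Prop :=
  ∀ m : ℕ, 1 ≤ m → ∀ K : ℕ, ∀ lam : Fin K → ℕ,
    (∀ j, 1 < lam j) →
    (∀ j k : Fin K, j ≤ k → lam j ∣ lam k) →
    Nonempty ((ZMod m)ˣ ≃* Multiplicative (∀ j : Fin K, ZMod (lam j))) →
    J m = (Finset.univ.filter fun j : Fin K => lam j = d).card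

/-- The number of `m ∈ {1, …, n}` satisfying `P`. -/
def cnt (P : ℕ → Prop) (n : ℕ) : ℕ := {m : ℕ | 1 ≤ m ∧ m ≤ n ∧ P m}.ncard

/-- The average `(1/n)·∑_{m=1}^n J(m)`. -/
def avg (J : ℕ → ℕ) (n : ℕ) : ℝ := (∑ m ∈ Finset.Icc 1 n, (J m : ℝ)) / n

/-- `log log n`. -/
def LL (n : ℕ) : ℝ := Real.log (Real.log n)

/-- The standard normal cumulative distribution function. -/
def Phi (x : ℝ) : ℝ := (Real.sqrt (2 * Real.pi))⁻¹ * ∫ t in Set.Iic x, Real.exp (-t ^ 2 / 2)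

/-- Owen's T-function. -/
def OwenT (h a : ℝ) : ℝ :=
  (2 * Real.pi)⁻¹ * ∫ t in (0:ℝ)..a, Real.exp (-(1 + t ^ 2) * h ^ 2 / 2) / (1 + t ^ 2)

/-- The skew-normal cumulative distribution function with parameter `α`. -/
def PhiSkew (x α : ℝ) : ℝ := Phi x - 2 * OwenT x α

/-- The standard Gaussian probability measure `γ^k` on `ℝ^k`. -/
def stdGaussian (k : ℕ) : Measure (Fin k → ℝ) :=
  Measure.pi fun _ => gaussianReal 0 1

/-- `ω(m;q,1)`: the number of distinct primes `p ∣ m` with `p ≡ 1 (mod q)`. -/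
def omegaQ (m q : ℕ) : ℕ := (m.primeFactors.filter fun p => p % q = 1 % q).card

/-- The correction term `Ē(m;p^α)`. -/
def Ebar (m p α : ℕ) : ℕ :=
  if p ^ α = 2 ∧ 8 ∣ m then 2
  else if p ^ α = 2 ∧ 4 ∣ m ∧ ¬(8 ∣ m) then 1
  else if p = 2 ∧ 2 ≤ α ∧ 2 ^ (α + 2) ∣ m then 1
  else if p ≠ 2 ∧ p ^ (α + 1) ∣ m then 1
  else 0

/-- `prm(m;q)` for a prime power `q = p^α`: the unique `k` such that `p^k` is the cardinality
of the subgroup `{x ∈ (ℤ/mℤ)ˣ : x^p = 1 and x = y^{p^{α−1}} for some y}` (obtained here as the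
`p`-adic valuation of that cardinality; note `p = q.minFac` and `p^{α−1} = q / p`). -/
def prm (m q : ℕ) : ℕ :=
  (Nat.card {x : (ZMod m)ˣ // x ^ q.minFac = 1 ∧ ∃ y : (ZMod m)ˣ, y ^ (q / q.minFac) = x}).factorization
    q.minFac

/-- `m` is `y`-typical: for all prime powers `q₁, q₂` with `φ(q₁) ≤ y` and `φ(q₁) < φ(q₂)`
one has `prm(m;q₁) > prm(m;q₂)`. -/
def yTypical (y : ℝ) (m : ℕ) : Prop :=
  ∀ q₁ q₂ : ℕ, IsPrimePow q₁ → IsPrimePow q₂ →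
    (Nat.totient q₁ : ℝ) ≤ y → Nat.totient q₁ < Nat.totient q₂ →
    prm m q₂ < prm m q₁



/-- The indicator function of the primes congruent to `1` modulo `q`. -/
def primeInd (q n : ℕ) : ℝ := if n.Prime ∧ (n : ZMod q) = 1 then 1 else 0

lemma primeInd_nonneg (q n : ℕ) : 0 ≤ primeInd q n := by
  unfold primeInd; split_ifs <;> simp

lemma primeInd_le_one (q n : ℕ) : primeInd q n ≤ 1 := by
  unfold primeInd; split_ifs <;> simp

@[simp] lemma primeInd_zero (q : ℕ) : primeInd q 0 = 0 := by
  simp [primeInd, Nat.not_prime_zero]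

/-- The sum of `p ^ (-x)` over the primes `p` congruent to `1` modulo `q`. -/
def primeSeries (q : ℕ) (x : ℝ) : ℝ := ∑' n : ℕ, primeInd q n / (n : ℝ) ^ x

lemma summable_primeInd (q : ℕ) {x : ℝ} (hx : 1 < x) :
    Summable fun n : ℕ => primeInd q n / (n : ℝ) ^ x := by
  refine (Real.summable_one_div_nat_rpow.mpr hx).of_nonneg_of_le (fun n => ?_) fun n => ?_
  · have := primeInd_nonneg q n
    positivity
  · have := primeInd_le_one q n
    gcongr

lemma LSeries_ofReal_eq_tsum {f : ℕ → ℝ} (hf : f 0 = 0) (x : ℝ) :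
    LSeries (fun n => (f n : ℂ)) x = ((∑' n : ℕ, f n / (n : ℝ) ^ x : ℝ) : ℂ) := by
  simp only [LSeries, Complex.ofReal_tsum, Complex.ofReal_div,
    Complex.ofReal_cpow (Nat.cast_nonneg _), Complex.ofReal_natCast]
  refine tsum_congr fun n => ?_
  rcases eq_or_ne n 0 with rfl | hn
  · simp [hf]
  · simp [LSeries.term_of_ne_zero hn]

open ArithmeticFunction.vonMangoldt in
lemma exists_abs_tsum_residueClass_sub_le (q : ℕ) [NeZero q] :
    ∃ C : ℝ, ∀ x : ℝ, x ∈ Set.Ioc 1 2 →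
      |∑' n : ℕ, residueClass (1 : ZMod q) n / (n : ℝ) ^ x - (q.totient : ℝ)⁻¹ / (x - 1)| ≤ C := by
  have H {x : ℝ} (hx : 1 < x) :
      ∑' n, residueClass (1 : ZMod q) n / (n : ℝ) ^ x - (q.totient : ℝ)⁻¹ / (x - 1) =
        (LFunctionResidueClassAux (1 : ZMod q) x).re := by
    apply Complex.ofReal_injective
    rw [← LFunctionResidueClassAux_real isUnit_one hx,
      eqOn_LFunctionResidueClassAux isUnit_one (show (1 : ℝ) < (x : ℂ).re from hx)]
    simp only
    rw [LSeries_ofReal_eq_tsum (residueClass_apply_zero _)]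
    push_cast
    rfl
  have hc : ContinuousOn (fun x : ℝ ↦ (LFunctionResidueClassAux (1 : ZMod q) x).re)
      (Set.Icc 1 2) :=
    Complex.continuous_re.continuousOn.comp (t := Set.univ)
      (continuousOn_LFunctionResidueClassAux (1 : ZMod q)) (fun _ _ ↦ trivial) |>.comp
      Complex.continuous_ofReal.continuousOn fun x hx ↦ by
        simpa using hx.1
  obtain ⟨C, hC⟩ := isCompact_Icc.exists_bound_of_continuousOn hc
  refine ⟨C, fun x hx => ?_⟩
  rw [H hx.1]
  exact hC x ⟨hx.1.le, hx.2⟩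

open ArithmeticFunction.vonMangoldt in
lemma exists_abs_tsum_log_sub_le (q : ℕ) [NeZero q] :
    ∃ C : ℝ, ∀ x : ℝ, x ∈ Set.Ioc 1 2 →
      |∑' n : ℕ, (Real.log n * primeInd q n) / (n : ℝ) ^ x - (q.totient : ℝ)⁻¹ / (x - 1)| ≤ C := by
  obtain ⟨C, hC⟩ := exists_abs_tsum_residueClass_sub_le q
  set g : ℕ → ℝ := fun n => if n.Prime then 0 else residueClass (1 : ZMod q) n with hg
  have hg0 (n : ℕ) : 0 ≤ g n := by
    simp only [hg]; split_ifs
    exacts [le_rfl, residueClass_nonneg _ _]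
  have hgs : Summable fun n : ℕ => g n / n := summable_residueClass_non_primes_div (1 : ZMod q)
  refine ⟨C + ∑' n : ℕ, g n / n, fun x hx => ?_⟩
  have hle (n : ℕ) : g n / (n : ℝ) ^ x ≤ g n / n := by
    rcases n.eq_zero_or_pos with rfl | hn
    · simp [hg]
    · refine div_le_div_of_nonneg_left (hg0 n) (mod_cast hn) ?_
      conv_lhs => rw [← Real.rpow_one n]
      exact Real.rpow_le_rpow_of_exponent_le (by exact_mod_cast hn) hx.1.le
  have hnn (n : ℕ) : 0 ≤ g n / (n : ℝ) ^ x := div_nonneg (hg0 n) (by positivity)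
  have hs : Summable fun n : ℕ => g n / (n : ℝ) ^ x := hgs.of_nonneg_of_le hnn hle
  have hr : Summable fun n : ℕ => residueClass (1 : ZMod q) n / (n : ℝ) ^ x :=
    LSeries.summable_real_of_abscissaOfAbsConv_lt <|
        (abscissaOfAbsConv_residueClass_le_one _).trans_lt <| mod_cast hx.1
  have heq : ∑' n : ℕ, (Real.log n * primeInd q n) / (n : ℝ) ^ x =
      ∑' n : ℕ, residueClass (1 : ZMod q) n / (n : ℝ) ^ x - ∑' n : ℕ, g n / (n : ℝ) ^ x := by
    rw [← hr.tsum_sub hs]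
    refine tsum_congr fun n => ?_
    rw [← sub_div]
    congr 1
    by_cases hp : n.Prime
    · by_cases h1 : (n : ZMod q) = 1
      · simp [hg, hp, h1, primeInd, residueClass, ArithmeticFunction.vonMangoldt_apply_prime hp]
      · simp [hg, hp, h1, primeInd, residueClass]
    · simp [hg, hp, primeInd]
  have h1 : ∑' n : ℕ, g n / (n : ℝ) ^ x ≤ ∑' n : ℕ, g n / n := hs.tsum_le_tsum hle hgs
  have h2 : 0 ≤ ∑' n : ℕ, g n / (n : ℝ) ^ x := tsum_nonneg hnn
  have h3 := abs_le.mp (hC x hx)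
  rw [heq, abs_le]
  constructor <;> linarith [h3.1, h3.2]

lemma hasDerivAt_primeSeries (q : ℕ) {x : ℝ} (hx : 1 < x) :
    HasDerivAt (primeSeries q) (-∑' n : ℕ, (Real.log n * primeInd q n) / (n : ℝ) ^ x) x := by
  have habs : LSeries.abscissaOfAbsConv (fun n => (primeInd q n : ℂ)) < (x : ℂ).re := by
    refine lt_of_le_of_lt (LSeries.abscissaOfAbsConv_le_of_forall_lt_LSeriesSummable (x := 1)
      fun y hy => ?_) (by exact_mod_cast hx)
    refine (summable_primeInd q hy).of_norm_bounded fun n => ?_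
    rcases eq_or_ne n 0 with rfl | hn
    · simp
    · rw [LSeries.term_of_ne_zero hn, norm_div, Complex.norm_natCast_cpow_of_pos (by lia)]
      simp [abs_of_nonneg (primeInd_nonneg q n)]
  have h := (LSeries_hasDerivAt habs).real_of_complex
  have hB : (fun y : ℝ => (LSeries (fun n => (primeInd q n : ℂ)) y).re) = primeSeries q := by
    funext y
    rw [LSeries_ofReal_eq_tsum (primeInd_zero q), Complex.ofReal_re, primeSeries]
  have hL : LSeries.logMul (fun n => (primeInd q n : ℂ)) =
      fun n : ℕ => ((Real.log n * primeInd q n : ℝ) : ℂ) := by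
    funext n
    simp [LSeries.logMul, Complex.natCast_log]
  rw [hB, hL, LSeries_ofReal_eq_tsum (by simp)] at h
  simpa only [← Complex.ofReal_neg, Complex.ofReal_re] using h

lemma exists_abs_primeSeries_add_log_le (q : ℕ) [NeZero q] :
    ∃ C : ℝ, ∀ x : ℝ, x ∈ Set.Ioc 1 2 →
      |primeSeries q x + (q.totient : ℝ)⁻¹ * Real.log (x - 1)| ≤ C := by
  obtain ⟨C, hC⟩ := exists_abs_tsum_log_sub_le q
  set G : ℝ → ℝ := fun x => primeSeries q x + (q.totient : ℝ)⁻¹ * Real.log (x - 1) with hG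
  have hd (x : ℝ) (hx : x ∈ Set.Ioc (1 : ℝ) 2) : HasDerivWithinAt G
      (-∑' n : ℕ, (Real.log n * primeInd q n) / (n : ℝ) ^ x + (q.totient : ℝ)⁻¹ * (1 / (x - 1)))
      (Set.Ioc 1 2) x :=
    ((hasDerivAt_primeSeries q hx.1).add
      ((((hasDerivAt_id x).sub_const 1).log (sub_ne_zero.mpr hx.1.ne')).const_mul
        _)).hasDerivWithinAt
  refine ⟨C + |G 2|, fun x hx => ?_⟩
  have h2 : (2 : ℝ) ∈ Set.Ioc (1 : ℝ) 2 := by norm_num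
  have h := (convex_Ioc (1 : ℝ) 2).norm_image_sub_le_of_norm_hasDerivWithin_le (C := C) hd
    (fun y hy => by
      rw [Real.norm_eq_abs, ← abs_neg]
      convert hC y hy using 2
      ring) h2 hx
  have hC0 : 0 ≤ C := (abs_nonneg _).trans (hC 2 h2)
  have hx1 : ‖x - 2‖ ≤ 1 := by
    rw [Real.norm_eq_abs, abs_le]; constructor <;> linarith [hx.1, hx.2]
  rw [Real.norm_eq_abs] at h
  calc |G x| = |(G x - G 2) + G 2| := by ring_nf
    _ ≤ |G x - G 2| + |G 2| := abs_add_le _ _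
    _ ≤ C + |G 2| := by nlinarith

/-- The partial sum up to `N` of the reciprocals of the primes congruent to `1` modulo `q`. -/
def primeRecip (q N : ℕ) : ℝ := ∑ n ∈ Finset.range (N + 1), primeInd q n / n

lemma tendsto_log_log_atTop : Tendsto (fun N : ℕ => Real.log (Real.log N)) atTop atTop :=
  Real.tendsto_log_atTop.comp (Real.tendsto_log_atTop.comp tendsto_natCast_atTop_atTop)

lemma tendsto_primeSeries_div_log_log (q : ℕ) [NeZero q] {K : ℝ} (hK : 0 < K) :
    Tendsto (fun N : ℕ => primeSeries q (1 + K / Real.log N) / Real.log (Real.log N)) atTop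
      (nhds (q.totient : ℝ)⁻¹) := by
  obtain ⟨C, hC⟩ := exists_abs_primeSeries_add_log_le q
  have hL : Tendsto (fun N : ℕ => Real.log N) atTop atTop :=
    Real.tendsto_log_atTop.comp tendsto_natCast_atTop_atTop
  have hl := tendsto_log_log_atTop
  have hz : Tendsto (fun N : ℕ => primeSeries q (1 + K / Real.log N) / Real.log (Real.log N)
      - (q.totient : ℝ)⁻¹) atTop (nhds 0) := by
    refine squeeze_zero_norm' ?_ ((tendsto_const_nhds
      (x := C + |(q.totient : ℝ)⁻¹ * Real.log K|)).div_atTop hl)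
    filter_upwards [hL.eventually_ge_atTop K, hL.eventually_gt_atTop 0,
      hl.eventually_gt_atTop 0] with N h1 h2 h3
    have hx : 1 + K / Real.log N ∈ Set.Ioc (1 : ℝ) 2 := by
      have : K / Real.log N ≤ 1 := (div_le_one h2).mpr h1
      have : 0 < K / Real.log N := by positivity
      constructor <;> linarith
    have h := hC _ hx
    rw [add_sub_cancel_left, Real.log_div hK.ne' h2.ne'] at h
    rw [Real.norm_eq_abs, show
      primeSeries q (1 + K / Real.log N) / Real.log (Real.log N) - (q.totient : ℝ)⁻¹ =
      ((primeSeries q (1 + K / Real.log N) + (q.totient : ℝ)⁻¹ * (Real.log K -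
        Real.log (Real.log N))) - (q.totient : ℝ)⁻¹ * Real.log K) / Real.log (Real.log N) by
        field_simp; ring, abs_div, abs_of_pos h3]
    gcongr
    exact (abs_sub _ _).trans (by gcongr)
  simpa using hz.add_const (q.totient : ℝ)⁻¹

lemma primeRecip_le (q : ℕ) {N : ℕ} (hN : 1 < N) {ε : ℝ} (hε : 0 < ε) :
    primeRecip q N ≤ Real.exp ε * primeSeries q (1 + ε / Real.log N) := by
  have hL : 0 < Real.log N := Real.log_pos (by exact_mod_cast hN)
  have hs := summable_primeInd q (x := 1 + ε / Real.log N) (by linarith [div_pos hε hL])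
  rw [primeSeries, ← tsum_mul_left]
  refine le_trans (Finset.sum_le_sum fun n hn => ?_) ((hs.mul_left _).sum_le_tsum _ fun n _ => ?_)
  · rcases n.eq_zero_or_pos with rfl | hn0
    · simp
    have hn' : (0 : ℝ) < n := by exact_mod_cast hn0
    have hle : (n : ℝ) ^ (ε / Real.log N) ≤ Real.exp ε := by
      rw [Real.rpow_def_of_pos hn']
      gcongr
      have : Real.log n ≤ Real.log N := Real.log_le_log hn' (by
        exact_mod_cast Nat.lt_succ_iff.mp (Finset.mem_range.mp hn))
      calc Real.log n * (ε / Real.log N) ≤ Real.log N * (ε / Real.log N) := by gcongr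
        _ = ε := by field_simp
    rw [Real.rpow_add hn', Real.rpow_one, ← mul_div_assoc, div_le_div_iff₀ hn' (by positivity)]
    have := mul_le_mul_of_nonneg_left hle (mul_nonneg (primeInd_nonneg q n) hn'.le)
    linarith
  · have := primeInd_nonneg q n
    positivity

lemma primeSeries_le (q : ℕ) {N : ℕ} (hN : 1 < N) {K : ℝ} (hK : 0 < K) :
    primeSeries q (1 + K / Real.log N) ≤
      primeRecip q N + Real.exp (-(K / 2)) * primeSeries q (1 + (K / 2) / Real.log N) := by
  have hL : 0 < Real.log N := Real.log_pos (by exact_mod_cast hN)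
  have hs := summable_primeInd q (x := 1 + K / Real.log N) (by linarith [div_pos hK hL])
  have hs2 := summable_primeInd q (x := 1 + (K / 2) / Real.log N)
    (by linarith [div_pos (half_pos hK) hL])
  rw [primeSeries, ← hs.sum_add_tsum_nat_add (N + 1)]
  refine add_le_add (Finset.sum_le_sum fun n _ => ?_) ?_
  · rcases n.eq_zero_or_pos with rfl | hn0
    · simp
    have hn' : (1 : ℝ) ≤ n := by exact_mod_cast hn0
    have := primeInd_nonneg q n
    gcongr
    conv_lhs => rw [← Real.rpow_one n]
    exact Real.rpow_le_rpow_of_exponent_le hn' (by linarith [div_pos hK hL])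
  · rw [primeSeries, ← tsum_mul_left]
    have hs2' := hs2.mul_left (Real.exp (-(K / 2)))
    rw [← hs2'.sum_add_tsum_nat_add (N + 1)]
    have ht := (summable_nat_add_iff (N + 1)).mpr hs
    have ht2 := (summable_nat_add_iff (N + 1)).mpr hs2'
    refine (ht.tsum_le_tsum (fun n => ?_) ht2).trans
      (le_add_of_nonneg_left (Finset.sum_nonneg fun n _ => ?_))
    · obtain ⟨m, hm⟩ : ∃ m, m = n + (N + 1) := ⟨_, rfl⟩
      rw [← hm]
      have hNm : (N : ℝ) ≤ m := by exact_mod_cast (by lia : N ≤ m)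
      have hn' : (0 : ℝ) < m := by exact_mod_cast (by lia : 0 < m)
      have hN0 : (0 : ℝ) < N := by exact_mod_cast (by lia : 0 < N)
      have hw := primeInd_nonneg q m
      have hle : Real.exp (K / 2) ≤ (m : ℝ) ^ (K / 2 / Real.log N) := by
        rw [Real.rpow_def_of_pos hn']
        gcongr
        have : Real.log N ≤ Real.log m := Real.log_le_log hN0 hNm
        calc K / 2 = Real.log N * (K / 2 / Real.log N) := by field_simp
          _ ≤ _ := by gcongr
      have hsplit : (m : ℝ) ^ (1 + K / Real.log N) =
          (m : ℝ) ^ (1 + K / 2 / Real.log N) * (m : ℝ) ^ (K / 2 / Real.log N) := by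
        rw [← Real.rpow_add hn']; congr 1; ring
      rw [hsplit, Real.exp_neg, ← div_eq_inv_mul, ← div_div]
      gcongr
    · have := primeInd_nonneg q n
      positivity

/-- Mertens' theorem, to leading order, for the primes congruent to `1` modulo `q`. -/
lemma tendsto_primeRecip_div_log_log (q : ℕ) [NeZero q] :
    Tendsto (fun N : ℕ => primeRecip q N / Real.log (Real.log N)) atTop
      (nhds (q.totient : ℝ)⁻¹) := by
  set c : ℝ := (q.totient : ℝ)⁻¹
  have hev : ∀ᶠ N : ℕ in atTop, 1 < N ∧ 0 < Real.log (Real.log N) :=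
    (eventually_gt_atTop 1).and (tendsto_log_log_atTop.eventually_gt_atTop 0)
  rw [tendsto_order]
  constructor
  · intro b hb
    have hlim : Tendsto (fun K : ℝ => c - Real.exp (-(K / 2)) * c) atTop
        (nhds (c - 0 * c)) := by
      refine tendsto_const_nhds.sub (Tendsto.mul_const _ ?_)
      exact Real.tendsto_exp_neg_atTop_nhds_zero.comp (tendsto_id.atTop_div_const two_pos)
    rw [zero_mul, sub_zero] at hlim
    obtain ⟨K, hKb, hK⟩ := ((hlim.eventually_const_lt hb).and (eventually_gt_atTop 0)).exists
    have h := (tendsto_primeSeries_div_log_log q hK).sub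
      ((tendsto_primeSeries_div_log_log q (half_pos hK)).const_mul (Real.exp (-(K / 2))))
    filter_upwards [h.eventually_const_lt hKb, hev] with N h1 ⟨h2, h3⟩
    refine h1.trans_le ?_
    rw [← mul_div_assoc, ← sub_div]
    gcongr
    linarith [primeSeries_le q h2 hK]
  · intro b hb
    have hlim : Tendsto (fun ε : ℝ => Real.exp ε * c) (nhdsWithin 0 (Set.Ioi 0))
        (nhds (Real.exp 0 * c)) :=
      ((Real.continuous_exp.tendsto 0).mono_left nhdsWithin_le_nhds).mul_const c
    rw [Real.exp_zero, one_mul] at hlim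
    obtain ⟨ε, hεb, hε⟩ := ((hlim.eventually_lt_const hb).and self_mem_nhdsWithin).exists
    have h := (tendsto_primeSeries_div_log_log q hε).const_mul (Real.exp ε)
    filter_upwards [h.eventually_lt_const hεb, hev] with N h1 ⟨h2, h3⟩
    refine lt_of_le_of_lt ?_ h1
    rw [← mul_div_assoc]
    gcongr
    exact primeRecip_le q h2 hε

lemma sum_Icc_indicator_dvd (n d : ℕ) :
    ∑ m ∈ Finset.Icc 1 n, (if d ∣ m then (1 : ℝ) else 0) = (n / d : ℕ) := by
  rw [Finset.sum_boole, ← Nat.Ioc_filter_dvd_card_eq_div]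
  rfl

lemma natDiv_mem (n d : ℕ) :
    ((n / d : ℕ) : ℝ) ≤ n / d ∧ (n : ℝ) / d - 1 ≤ (n / d : ℕ) := by
  refine ⟨Nat.cast_div_le, ?_⟩
  have := Nat.lt_floor_add_one ((n : ℝ) / d)
  rw [Nat.floor_div_eq_div] at this
  linarith

/-- A bound for the covariance of divisibility by two primes. -/
lemma sum_covariance_le (n : ℕ) {p p' : ℕ} (hp : p.Prime) (hp' : p'.Prime) :
    |∑ m ∈ Finset.Icc 1 n, ((if p ∣ m then (1 : ℝ) else 0) - 1 / p) *
      ((if p' ∣ m then (1 : ℝ) else 0) - 1 / p')| ≤ 2 + if p = p' then (n : ℝ) / p else 0 := by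
  have hp1 : (0 : ℝ) < p := by exact_mod_cast hp.pos
  have hp1' : (0 : ℝ) < p' := by exact_mod_cast hp'.pos
  have hp2 : 1 / (p : ℝ) ≤ 1 / 2 := one_div_le_one_div_of_le two_pos (by exact_mod_cast hp.two_le)
  have hp2' : 1 / (p' : ℝ) ≤ 1 / 2 :=
    one_div_le_one_div_of_le two_pos (by exact_mod_cast hp'.two_le)
  have hp0 : 0 < 1 / (p : ℝ) := by positivity
  have hp0' : 0 < 1 / (p' : ℝ) := by positivity
  have hexp : ∑ m ∈ Finset.Icc 1 n, ((if p ∣ m then (1 : ℝ) else 0) - 1 / p) *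
      ((if p' ∣ m then (1 : ℝ) else 0) - 1 / p') =
      ∑ m ∈ Finset.Icc 1 n, (if p ∣ m ∧ p' ∣ m then (1 : ℝ) else 0)
      - (n / p : ℕ) * (1 / p') - (n / p' : ℕ) * (1 / p) + n * (1 / p * (1 / p')) := by
    rw [← sum_Icc_indicator_dvd, ← sum_Icc_indicator_dvd, Finset.sum_mul, Finset.sum_mul,
      ← Finset.sum_sub_distrib, ← Finset.sum_sub_distrib]
    have : (n : ℝ) * (1 / p * (1 / p')) = ∑ m ∈ Finset.Icc 1 n, (1 / p * (1 / p') : ℝ) := by simp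
    rw [this, ← Finset.sum_add_distrib]
    refine Finset.sum_congr rfl fun m _ => ?_
    split_ifs <;> first | tauto | ring1
  rw [hexp]
  obtain ⟨a1, a2⟩ := natDiv_mem n p
  obtain ⟨b1, b2⟩ := natDiv_mem n p'
  rw [div_eq_mul_one_div] at a1 a2 b1 b2
  have hn : (0 : ℝ) ≤ n := n.cast_nonneg
  split_ifs with h
  · subst h
    simp only [and_self]
    rw [sum_Icc_indicator_dvd, div_eq_mul_one_div (n : ℝ)]
    rw [abs_le]
    set u := 1 / (p : ℝ)
    set k : ℝ := ((n / p : ℕ) : ℝ)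
    have hk : 0 ≤ k := Nat.cast_nonneg _
    constructor
    · nlinarith [mul_nonneg hn hp0.le, mul_nonneg hk hp0.le, mul_nonneg hk (sub_nonneg.mpr hp2),
        mul_nonneg (mul_nonneg hn hp0.le) hp0.le]
    · nlinarith [mul_nonneg hn hp0.le, mul_nonneg hk hp0.le, mul_nonneg hk (sub_nonneg.mpr hp2),
        mul_nonneg (mul_nonneg hn hp0.le) (sub_nonneg.mpr hp2)]
  · have hcop : p.Coprime p' := (Nat.coprime_primes hp hp').mpr h
    have hand : ∀ m : ℕ, (p ∣ m ∧ p' ∣ m) ↔ p * p' ∣ m := fun m =>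
      ⟨fun hm => hcop.mul_dvd_of_dvd_of_dvd hm.1 hm.2,
        fun hm => ⟨dvd_of_mul_right_dvd hm, dvd_of_mul_left_dvd hm⟩⟩
    simp only [hand]
    rw [sum_Icc_indicator_dvd]
    obtain ⟨c1, c2⟩ := natDiv_mem n (p * p')
    have hc : (n : ℝ) / (p * p' : ℕ) = n * (1 / p * (1 / p')) := by
      push_cast; field_simp
    rw [hc] at c1 c2
    set u := 1 / (p : ℝ)
    set v := 1 / (p' : ℝ)
    have e1 := mul_le_mul_of_nonneg_right a1 hp0'.le
    have e2 := mul_le_mul_of_nonneg_right a2 hp0'.le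
    have e3 := mul_le_mul_of_nonneg_right b1 hp0.le
    have e4 := mul_le_mul_of_nonneg_right b2 hp0.le
    rw [abs_le]
    constructor <;> nlinarith

/-- The Turán–Kubilius inequality, for weights supported on a set of primes. -/
lemma sum_sq_sub_le (n : ℕ) (S : Finset ℕ) (hS : ∀ p ∈ S, p.Prime) (w : ℕ → ℝ)
    (hw : ∀ p, |w p| ≤ 1) :
    ∑ m ∈ Finset.Icc 1 n, (∑ p ∈ S, w p * ((if p ∣ m then (1 : ℝ) else 0) - 1 / p)) ^ 2 ≤
      n * ∑ p ∈ S, |w p| / p + 2 * (S.card : ℝ) ^ 2 := by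
  calc _ = ∑ p ∈ S, ∑ p' ∈ S, w p * w p' *
        ∑ m ∈ Finset.Icc 1 n, ((if p ∣ m then (1 : ℝ) else 0) - 1 / p) *
          ((if p' ∣ m then (1 : ℝ) else 0) - 1 / p') := by
        simp_rw [Finset.mul_sum]
        rw [Finset.sum_congr rfl fun p _ => Finset.sum_comm, Finset.sum_comm]
        refine Finset.sum_congr rfl fun m _ => ?_
        rw [sq, Finset.sum_mul_sum]
        refine Finset.sum_congr rfl fun p _ => Finset.sum_congr rfl fun p' _ => ?_
        ring
    _ ≤ ∑ p ∈ S, ∑ p' ∈ S, (2 + if p = p' then |w p| * ((n : ℝ) / p) else 0) := by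
        refine Finset.sum_le_sum fun p hp => Finset.sum_le_sum fun p' hp' => ?_
        refine (le_abs_self _).trans ?_
        rw [abs_mul, abs_mul]
        have h := sum_covariance_le n (hS p hp) (hS p' hp')
        have h1 : |w p| * |w p'| ≤ 1 := mul_le_one₀ (hw p) (abs_nonneg _) (hw p')
        have h2 : |w p| * |w p'| ≤ |w p| := mul_le_of_le_one_right (abs_nonneg _) (hw p')
        have h0 : 0 ≤ |w p| * |w p'| := by positivity
        refine (mul_le_mul_of_nonneg_left h h0).trans ?_
        split_ifs
        · have : (0 : ℝ) ≤ n / p := by positivity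
          nlinarith
        · nlinarith
    _ = _ := by
        simp only [Finset.sum_add_distrib, Finset.sum_const, nsmul_eq_mul, Finset.sum_ite_eq,
          Finset.mul_sum]
        rw [add_comm]
        congr 1
        · refine Finset.sum_congr rfl fun p hp => ?_
          rw [if_pos hp]; ring
        · ring

/-- A cyclic subgroup of maximal order is a retract of a finite abelian group. -/
lemma exists_retraction_zpowers {G : Type*} [CommGroup G] [Finite G] {g : G}
    (hg : orderOf g = Monoid.exponent G) :
    ∃ ρ : G →* Subgroup.zpowers g, ∀ x : Subgroup.zpowers g, ρ x = x := by
  set N := Monoid.exponent G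
  have : NeZero N := ⟨Monoid.exponent_ne_zero_of_finite⟩
  let e : Subgroup.zpowers g ≃* rootsOfUnity N ℂ :=
    mulEquivOfCyclicCardEq (by rw [Nat.card_zpowers, hg, Complex.card_rootsOfUnity])
  obtain ⟨χ, hχ⟩ := MonoidHom.domRestrict_surjective (M := ℂ) (Subgroup.zpowers g)
    ((rootsOfUnity N ℂ).subtype.comp e.toMonoidHom)
  have hmem (x : G) : χ x ∈ rootsOfUnity N ℂ := by
    rw [mem_rootsOfUnity, ← map_pow, Monoid.pow_exponent_eq_one, map_one]
  refine ⟨e.symm.toMonoidHom.comp (χ.codRestrict _ hmem), fun x => ?_⟩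
  apply e.injective
  have := DFunLike.congr_fun hχ x
  ext1
  simpa using this

lemma exists_mulEquiv_prod_zmod_exponent (G : Type) [CommGroup G] [Finite G] :
    ∃ (H : Subgroup G),
      Nonempty (G ≃* Multiplicative (ZMod (Monoid.exponent G)) × H) := by
  obtain ⟨g, hg⟩ := Monoid.exists_orderOf_eq_exponent (Monoid.ExponentExists.of_finite (G := G))
  obtain ⟨ρ, hρ⟩ := exists_retraction_zpowers hg
  have e : Multiplicative (ZMod (Monoid.exponent G)) ≃* Subgroup.zpowers g :=
    zmodMulEquivOfGenerator (g := ⟨g, Subgroup.mem_zpowers g⟩)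
      (by
        rintro ⟨x, k, rfl⟩
        exact ⟨k, rfl⟩) (by rw [Nat.card_zpowers, hg])
  let f : Subgroup.zpowers g × ρ.ker →* G :=
    (Subgroup.zpowers g).subtype.coprod ρ.ker.subtype
  have hf : Function.Bijective f := by
    constructor
    · rw [injective_iff_map_eq_one]
      rintro ⟨a, b⟩ hab
      have hab' : (a : G) * b = 1 := hab
      have ha : a = 1 := by
        have h := congrArg ρ hab'
        rwa [map_mul, hρ, (MonoidHom.mem_ker).mp b.2, mul_one, map_one] at h
      subst ha
      simpa using hab'
    · intro x
      refine ⟨(ρ x, ⟨(ρ x : G)⁻¹ * x, ?_⟩), ?_⟩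
      · rw [MonoidHom.mem_ker, map_mul, map_inv, hρ, inv_mul_cancel]
      · simp [f]
  exact ⟨ρ.ker, ⟨(MulEquiv.ofBijective f hf).symm.trans (e.symm.prodCongr (MulEquiv.refl _))⟩⟩

lemma exists_descending_invariant_factors (n : ℕ) :
    ∀ (G : Type) [CommGroup G] [Finite G], Nat.card G ≤ n → ∃ (K : ℕ) (lam : Fin K → ℕ),
      (∀ j, 1 < lam j) ∧ (∀ j, lam j ∣ Monoid.exponent G) ∧ (∀ j k, j ≤ k → lam k ∣ lam j) ∧
      Nonempty (G ≃* ∀ j, Multiplicative (ZMod (lam j))) := by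
  induction n with
  | zero =>
    intro G _ _ h
    have := Nat.card_pos (α := G)
    lia
  | succ n ih =>
    intro G _ _ h
    rcases subsingleton_or_nontrivial G with hG | hG
    · have : Unique G := uniqueOfSubsingleton 1
      exact ⟨0, Fin.elim0, fun j => j.elim0, fun j => j.elim0, fun j => j.elim0,
        ⟨(MulEquiv.ofUnique : G ≃* _)⟩⟩
    obtain ⟨H, ⟨e⟩⟩ := exists_mulEquiv_prod_zmod_exponent G
    have hN1 : 1 < Monoid.exponent G := Monoid.one_lt_exponent
    have hcard := Nat.card_congr e.toEquiv
    have hzm : Nat.card (Multiplicative (ZMod (Monoid.exponent G))) = Monoid.exponent G :=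
      Nat.card_zmod _
    rw [Nat.card_prod, hzm] at hcard
    have hHpos := Nat.card_pos (α := H)
    obtain ⟨K, lam, h1, h2, h3, ⟨e'⟩⟩ := ih H (by nlinarith)
    have hexp : Monoid.exponent H ∣ Monoid.exponent G :=
      Monoid.exponent_dvd_of_monoidHom H.subtype H.subtype_injective
    refine ⟨K + 1, Fin.cons (Monoid.exponent G) lam, ?_, ?_, ?_, ⟨?_⟩⟩
    · exact Fin.cases hN1 h1
    · exact Fin.cases dvd_rfl fun j => (h2 j).trans hexp
    · refine Fin.cases (Fin.cases (fun _ => dvd_rfl) fun k _ => (h2 k).trans hexp) fun j =>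
        Fin.cases (fun hk => absurd hk (by simp)) fun k hk => h3 j k (by simpa using hk)
    · refine (e.trans ((MulEquiv.refl _).prodCongr e')).trans
        { Fin.consEquiv (fun j => Multiplicative
            (ZMod ((Fin.cons (Monoid.exponent G) lam : Fin (K + 1) → ℕ) j))) with
          map_mul' := fun x y => ?_ }
      funext j
      refine Fin.cases ?_ (fun j => ?_) j <;> rfl

/-- The invariant factor decomposition of a finite abelian group. -/
lemma exists_invariant_factors (G : Type) [CommGroup G] [Finite G] :
    ∃ (K : ℕ) (lam : Fin K → ℕ), (∀ j, 1 < lam j) ∧ (∀ j k, j ≤ k → lam j ∣ lam k) ∧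
      Nonempty (G ≃* Multiplicative (∀ j, ZMod (lam j))) := by
  obtain ⟨K, lam, h1, -, h3, ⟨e⟩⟩ := exists_descending_invariant_factors _ G le_rfl
  refine ⟨K, fun j => lam j.rev, fun j => h1 _, fun j k hjk => h3 _ _ (Fin.rev_le_rev.mpr hjk), ⟨?_⟩⟩
  refine (e.trans ?_).trans (MulEquiv.piMultiplicative fun j : Fin K => ZMod (lam j.rev)).symm
  exact MulEquiv.symm
    { (Equiv.piCongrLeft (fun j => Multiplicative (ZMod (lam j))) (Fin.revPerm (n := K))) with
      map_mul' := fun x y => by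
        funext j
        obtain ⟨i, rfl⟩ := Fin.revPerm.surjective j
        let P := fun j => Multiplicative (ZMod (lam j))
        have h := Equiv.piCongrLeft_apply_apply P (Fin.revPerm (n := K))
        exact (h (x * y) i).trans (congrArg₂ (· * ·) (h x i) (h y i)).symm }

/-- The number of solutions of `x ^ k = 1` in `G`. -/
def torsionCard (k : ℕ) (G : Type) [CommGroup G] : ℕ :=
  Nat.card (powMonoidHom k : G →* G).ker

lemma torsionCard_pos (k : ℕ) (G : Type) [CommGroup G] [Finite G] : 0 < torsionCard k G :=
  Nat.card_pos

lemma torsionCard_mono {k l : ℕ} (h : k ∣ l) (G : Type) [CommGroup G] [Finite G] :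
    torsionCard k G ≤ torsionCard l G := by
  refine Nat.card_le_card_of_injective (Subgroup.inclusion fun x hx => ?_)
    (Subgroup.inclusion_injective _)
  obtain ⟨c, rfl⟩ := h
  simp only [MonoidHom.mem_ker, powMonoidHom_apply] at hx ⊢
  rw [pow_mul, hx, one_pow]

lemma torsionCard_le_of_injective (k : ℕ) {G H : Type} [CommGroup G] [CommGroup H] [Finite H]
    (f : G →* H) (hf : Function.Injective f) : torsionCard k G ≤ torsionCard k H := by
  refine Nat.card_le_card_of_injective (fun x => ⟨f x.1, ?_⟩) fun x y hxy => ?_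
  · have := x.2
    simp only [MonoidHom.mem_ker, powMonoidHom_apply] at this ⊢
    rw [← map_pow, this, map_one]
  · exact Subtype.ext (hf (congrArg Subtype.val hxy))

lemma torsionCard_congr (k : ℕ) {G H : Type} [CommGroup G] [CommGroup H] [Finite G] [Finite H]
    (e : G ≃* H) : torsionCard k G = torsionCard k H :=
  le_antisymm (torsionCard_le_of_injective k e.toMonoidHom e.injective)
    (torsionCard_le_of_injective k e.symm.toMonoidHom e.symm.injective)

lemma torsionCard_pi (k : ℕ) {ι : Type} [Fintype ι] (G : ι → Type) [∀ i, CommGroup (G i)] :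
    torsionCard k (∀ i, G i) = ∏ i, torsionCard k (G i) := by
  simp only [torsionCard]
  rw [← Nat.card_pi]
  refine Nat.card_congr ((Equiv.subtypeEquivRight fun x => ?_).trans
    (Equiv.subtypePiEquivPi (p := fun i y => y ∈ (powMonoidHom k : G i →* G i).ker)))
  simp only [MonoidHom.mem_ker, powMonoidHom_apply, funext_iff, Pi.pow_apply, Pi.one_apply]

lemma torsionCard_of_isCyclic (k : ℕ) (G : Type) [CommGroup G] [Finite G] [IsCyclic G] :
    torsionCard k G = (Nat.card G).gcd k :=
  IsCyclic.card_powMonoidHom_ker G k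

lemma torsionCard_le_index_mul (k : ℕ) {G : Type} [CommGroup G] [Finite G] (H : Subgroup G) :
    torsionCard k G ≤ H.index * torsionCard k H := by
  set T := (powMonoidHom k : G →* G).ker
  have h1 : Nat.card (H.subgroupOf T) ≤ torsionCard k H := by
    refine Nat.card_le_card_of_injective (fun x => ⟨⟨x.1.1, x.2⟩, ?_⟩) fun x y hxy => ?_
    · have := x.1.2
      simp only [T, MonoidHom.mem_ker, powMonoidHom_apply] at this ⊢
      exact Subtype.ext this
    · exact Subtype.ext (Subtype.ext (congrArg (fun z => ((z.1 : H) : G)) hxy))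
  have h2 : (H.subgroupOf T).index ≤ H.index :=
    Nat.le_of_dvd (Nat.pos_of_ne_zero H.index_ne_zero_of_finite)
      (Subgroup.relIndex_dvd_index_of_normal H T)
  calc torsionCard k G = Nat.card (H.subgroupOf T) * (H.subgroupOf T).index :=
        (Subgroup.card_mul_index _).symm
    _ ≤ torsionCard k H * H.index := Nat.mul_le_mul h1 h2
    _ = _ := mul_comm _ _

lemma gcd_prime_pow_succ {l : ℕ} (hl : l.Prime) (a n : ℕ) :
    n.gcd (l ^ (a + 1)) = (if l ^ (a + 1) ∣ n then l else 1) * n.gcd (l ^ a) := by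
  split_ifs with h
  · rw [Nat.gcd_eq_right h, Nat.gcd_eq_right ((pow_dvd_pow l a.le_succ).trans h), pow_succ']
  · rw [one_mul]
    obtain ⟨b, hb, hb'⟩ := (Nat.dvd_prime_pow hl).mp (Nat.gcd_dvd_right n (l ^ (a + 1)))
    have hba : b ≤ a := by
      rcases hb.eq_or_lt with rfl | h'
      · exact absurd (hb' ▸ Nat.gcd_dvd_left n (l ^ (a + 1))) h
      · lia
    refine Nat.dvd_antisymm (Nat.dvd_gcd (Nat.gcd_dvd_left _ _) (hb' ▸ pow_dvd_pow l hba))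
      (Nat.gcd_dvd_gcd_of_dvd_right _ (pow_dvd_pow l a.le_succ))

lemma torsionCard_invariant_factors {l : ℕ} (hl : l.Prime) (a : ℕ) {G : Type} [CommGroup G]
    [Finite G] {K : ℕ} {lam : Fin K → ℕ} (hlam : ∀ j, 1 < lam j)
    (e : G ≃* Multiplicative (∀ j, ZMod (lam j))) :
    torsionCard (l ^ (a + 1)) G =
      l ^ (Finset.univ.filter fun j => l ^ (a + 1) ∣ lam j).card * torsionCard (l ^ a) G := by
  have hne (j : Fin K) : NeZero (lam j) := ⟨by have := hlam j; lia⟩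
  have hc (j : Fin K) : Nat.card (Multiplicative (ZMod (lam j))) = lam j := Nat.card_zmod _
  have e' := e.trans (MulEquiv.piMultiplicative fun j => ZMod (lam j))
  have hfin (j : Fin K) : Finite (Multiplicative (ZMod (lam j))) :=
    inferInstanceAs (Finite (ZMod (lam j)))
  rw [torsionCard_congr _ e', torsionCard_congr _ e', torsionCard_pi, torsionCard_pi]
  simp only [torsionCard_of_isCyclic, hc, gcd_prime_pow_succ hl]
  rw [Finset.prod_mul_distrib, Finset.prod_ite, Finset.prod_const, Finset.prod_const_one, mul_one]

lemma torsionCard_units_prime_pow {l : ℕ} (hl : l.Prime) (a : ℕ) {p : ℕ} (hp : p.Prime)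
    (hp2 : p ≠ 2) (v : ℕ) :
    torsionCard (l ^ (a + 1)) (ZMod (p ^ v))ˣ =
      (if l ^ (a + 1) ∣ (p ^ v).totient then l else 1) * torsionCard (l ^ a) (ZMod (p ^ v))ˣ := by
  have : NeZero (p ^ v) := ⟨(pow_pos hp.pos v).ne'⟩
  have := ZMod.isCyclic_units_of_prime_pow p hp hp2 v
  have hc : Nat.card (ZMod (p ^ v))ˣ = (p ^ v).totient := by
    rw [Nat.card_eq_fintype_card, ZMod.card_units_eq_totient]
  rw [torsionCard_of_isCyclic, torsionCard_of_isCyclic, hc, gcd_prime_pow_succ hl]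

lemma torsionCard_units_two_pow_le {l : ℕ} (hl : l.Prime) (a v : ℕ) :
    torsionCard (l ^ (a + 1)) (ZMod (2 ^ v))ˣ ≤ 2 * l * torsionCard (l ^ a) (ZMod (2 ^ v))ˣ := by
  have hl1 := hl.two_le
  have hpos := torsionCard_pos (l ^ a) (ZMod (2 ^ v))ˣ
  have hc : Nat.card (ZMod (2 ^ v))ˣ = (2 ^ v).totient := by
    rw [Nat.card_eq_fintype_card, ZMod.card_units_eq_totient]
  obtain ⟨H, hH, hind⟩ : ∃ H : Subgroup (ZMod (2 ^ v))ˣ, IsCyclic H ∧ H.index ≤ 2 := by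
    rcases lt_or_ge v 3 with hv | hv
    · refine ⟨⊥, inferInstance, ?_⟩
      rw [Subgroup.index_bot, hc]
      interval_cases v <;> decide
    · obtain ⟨n, rfl⟩ : ∃ n, v = n + 2 := ⟨v - 2, by lia⟩
      have hu : IsUnit (5 : ZMod (2 ^ (n + 2))) := by
        have := (ZMod.isUnit_iff_coprime 5 (2 ^ (n + 2))).mpr
          (Nat.Coprime.pow_right _ (by norm_num))
        simpa using this
      refine ⟨Subgroup.zpowers hu.unit, inferInstance, ?_⟩
      have h1 := Subgroup.card_mul_index (Subgroup.zpowers hu.unit)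
      rw [Nat.card_zpowers, ← orderOf_units, IsUnit.unit_spec, ZMod.orderOf_five, hc,
        Nat.totient_prime_pow_succ Nat.prime_two] at h1
      refine (Nat.eq_of_mul_eq_mul_left (by positivity : 0 < 2 ^ n) ?_).le
      rw [h1, pow_succ, Nat.add_one_sub_one, mul_one]
  have h2 : torsionCard (l ^ (a + 1)) H ≤ l * torsionCard (l ^ a) H := by
    rw [torsionCard_of_isCyclic, torsionCard_of_isCyclic, gcd_prime_pow_succ hl]
    gcongr
    split_ifs <;> lia
  calc _ ≤ H.index * torsionCard (l ^ (a + 1)) H := torsionCard_le_index_mul _ H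
    _ ≤ 2 * (l * torsionCard (l ^ a) (ZMod (2 ^ v))ˣ) := by
      gcongr
      exact h2.trans (Nat.mul_le_mul_left _ (torsionCard_le_of_injective _ H.subtype
        H.subtype_injective))
    _ = _ := by ring

lemma torsionCard_units (k : ℕ) {m : ℕ} (hm : m ≠ 0) :
    torsionCard k (ZMod m)ˣ = ∏ p ∈ m.primeFactors,
      torsionCard k (ZMod (p ^ m.factorization p))ˣ := by
  have : NeZero m := ⟨hm⟩
  have hne (p : m.primeFactors) : NeZero ((p : ℕ) ^ m.factorization p) :=
    ⟨(pow_pos (Nat.prime_of_mem_primeFactors p.2).pos _).ne'⟩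
  rw [torsionCard_congr k ((Units.mapEquiv (ZMod.equivPi m hm).toMulEquiv).trans MulEquiv.piUnits),
    torsionCard_pi, Finset.prod_coe_sort m.primeFactors
      (fun p => torsionCard k (ZMod (p ^ m.factorization p))ˣ)]

lemma pow_dvd_totient_of_mod_eq_one {q p v : ℕ} (hp : p.Prime) (hv : v ≠ 0)
    (h : p % q = 1 % q) : q ∣ (p ^ v).totient := by
  rw [Nat.totient_prime_pow hp (Nat.pos_of_ne_zero hv)]
  exact Dvd.dvd.mul_left ((Nat.modEq_iff_dvd' hp.one_lt.le).mp (Nat.ModEq.symm h)) _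

lemma mod_eq_one_of_pow_dvd_totient {l a p v : ℕ} (hl : l.Prime) (hp : p.Prime) (hpl : p ≠ l)
    (hv : v ≠ 0) (h : l ^ a ∣ (p ^ v).totient) : p % l ^ a = 1 % l ^ a := by
  rw [Nat.totient_prime_pow hp (Nat.pos_of_ne_zero hv)] at h
  have hcop : (l ^ a).Coprime (p ^ (v - 1)) :=
    Nat.Coprime.pow _ _ ((Nat.coprime_primes hl hp).mpr hpl.symm)
  exact ((Nat.modEq_iff_dvd' hp.one_lt.le).mpr (hcop.dvd_of_dvd_mul_left h)).symm

lemma prod_ite_mod_eq (m q l : ℕ) :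
    ∏ p ∈ m.primeFactors, (if p % q = 1 % q then l else 1) = l ^ omegaQ m q := by
  rw [Finset.prod_ite, Finset.prod_const, Finset.prod_const_one, mul_one, omegaQ]

lemma pow_omegaQ_mul_torsionCard_le {l : ℕ} (hl : l.Prime) (a : ℕ) {m : ℕ} (hm : m ≠ 0) :
    l ^ omegaQ m (l ^ (a + 1)) * torsionCard (l ^ a) (ZMod m)ˣ ≤
      torsionCard (l ^ (a + 1)) (ZMod m)ˣ := by
  rw [torsionCard_units _ hm, torsionCard_units _ hm, ← prod_ite_mod_eq, ← Finset.prod_mul_distrib]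
  refine Finset.prod_le_prod' fun p hpm => ?_
  have hp := Nat.prime_of_mem_primeFactors hpm
  have : NeZero (p ^ m.factorization p) := ⟨(pow_pos hp.pos _).ne'⟩
  split_ifs with h
  · have hv : m.factorization p ≠ 0 :=
      (hp.factorization_pos_of_dvd hm (Nat.dvd_of_mem_primeFactors hpm)).ne'
    have hp2 : p ≠ 2 := by
      rintro rfl
      have h2 : 2 ≤ l ^ (a + 1) := hl.two_le.trans (Nat.le_self_pow a.succ_ne_zero l)
      rw [Nat.one_mod_eq_one.mpr (by lia)] at h
      rcases h2.eq_or_lt with h2 | h2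
      · rw [← h2] at h; lia
      · rw [Nat.mod_eq_of_lt h2] at h; lia
    rw [torsionCard_units_prime_pow hl a hp hp2,
      if_pos (pow_dvd_totient_of_mod_eq_one hp hv h)]
  · rw [one_mul]
    exact torsionCard_mono (pow_dvd_pow l a.le_succ) _

lemma torsionCard_le_pow_omegaQ_mul {l : ℕ} (hl : l.Prime) (a : ℕ) {m : ℕ} (hm : m ≠ 0) :
    torsionCard (l ^ (a + 1)) (ZMod m)ˣ ≤
      l ^ (omegaQ m (l ^ (a + 1)) + 4) * torsionCard (l ^ a) (ZMod m)ˣ := by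
  have hl2 := hl.two_le
  have hbound (r : ℕ) : ∏ p ∈ m.primeFactors, (if r = p then 2 * l else 1) ≤ l ^ 2 := by
    rw [Finset.prod_ite_eq]
    split_ifs <;> nlinarith
  calc torsionCard (l ^ (a + 1)) (ZMod m)ˣ
      ≤ ∏ p ∈ m.primeFactors, ((if p % l ^ (a + 1) = 1 % l ^ (a + 1) then l else 1) *
          ((if 2 = p then 2 * l else 1) * (if l = p then 2 * l else 1)) *
          torsionCard (l ^ a) (ZMod (p ^ m.factorization p))ˣ) := by
        rw [torsionCard_units _ hm]
        refine Finset.prod_le_prod' fun p hpm => ?_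
        have hp := Nat.prime_of_mem_primeFactors hpm
        have : NeZero (p ^ m.factorization p) := ⟨(pow_pos hp.pos _).ne'⟩
        have hv : m.factorization p ≠ 0 :=
          (hp.factorization_pos_of_dvd hm (Nat.dvd_of_mem_primeFactors hpm)).ne'
        have h1 (P : Prop) [Decidable P] (b : ℕ) (hb : 1 ≤ b) : 1 ≤ if P then b else 1 := by
          split_ifs <;> lia
        have h2 := h1 (p % l ^ (a + 1) = 1 % l ^ (a + 1)) l (by lia)
        by_cases hp2 : 2 = p
        · subst hp2
          refine (torsionCard_units_two_pow_le hl a _).trans (Nat.mul_le_mul_right _ ?_)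
          rw [if_pos (rfl : 2 = 2)]
          have h3 := h1 (l = 2) (2 * l) (by lia)
          exact (le_mul_of_one_le_right (by lia) h3).trans (le_mul_of_one_le_left (by positivity) h2)
        · rw [torsionCard_units_prime_pow hl a hp (Ne.symm hp2), if_neg hp2, one_mul]
          refine Nat.mul_le_mul_right _ ?_
          by_cases hpl : l = p
          · rw [if_pos hpl]
            refine le_trans ?_ (le_mul_of_one_le_left (by lia) h2)
            split_ifs <;> lia
          · rw [if_neg hpl, mul_one]
            by_cases hd : l ^ (a + 1) ∣ (p ^ m.factorization p).totient
            · rw [if_pos hd,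
                if_pos (mod_eq_one_of_pow_dvd_totient hl hp (Ne.symm hpl) hv hd)]
            · rwa [if_neg hd]
    _ ≤ l ^ omegaQ m (l ^ (a + 1)) * (l ^ 2 * l ^ 2) * torsionCard (l ^ a) (ZMod m)ˣ := by
        rw [Finset.prod_mul_distrib, Finset.prod_mul_distrib, Finset.prod_mul_distrib,
          prod_ite_mod_eq, ← torsionCard_units _ hm]
        gcongr
        · exact hbound 2
        · exact hbound l
    _ = _ := by ring

/-- If `d` occurs as an invariant factor of the units modulo `m`, then the prime powers not
dividing `d` have essentially fewer associated prime factors of `m` than those dividing `d`. -/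
lemma omegaQ_lt_of_invCount_pos {d : ℕ} {J : ℕ → ℕ} (hJ : IsInvCount d J) {q r : ℕ}
    (hq : IsPrimePow q) (hr : IsPrimePow r) (hqd : ¬ q ∣ d) (hrd : r ∣ d) {m : ℕ} (hm : 1 ≤ m)
    (hpos : 0 < J m) : omegaQ m q < omegaQ m r + 4 := by
  have hm0 : m ≠ 0 := by lia
  have : NeZero m := ⟨hm0⟩
  obtain ⟨K, lam, h1, h2, ⟨e⟩⟩ := exists_invariant_factors (ZMod m)ˣ
  rw [hJ m hm K lam h1 h2 ⟨e⟩, Finset.card_pos] at hpos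
  obtain ⟨j, hj⟩ := hpos
  have hjd : lam j = d := (Finset.mem_filter.mp hj).2
  have hcard : (Finset.univ.filter fun k => q ∣ lam k).card <
      (Finset.univ.filter fun k => r ∣ lam k).card := by
    refine Finset.card_lt_card (Finset.ssubset_iff_subset_ne.mpr ⟨fun k hk => ?_, fun heq => ?_⟩)
    · simp only [Finset.mem_filter, Finset.mem_univ, true_and] at hk ⊢
      refine hrd.trans (hjd ▸ h2 j k (le_of_not_ge fun hkj => hqd ?_))
      exact hk.trans (hjd ▸ h2 k j hkj)
    · have : j ∈ Finset.univ.filter fun k => q ∣ lam k := by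
        rw [heq]; simpa [hjd] using hrd
      exact hqd (hjd ▸ (Finset.mem_filter.mp this).2)
  have key {s : ℕ} (hs : IsPrimePow s) :
      omegaQ m s ≤ (Finset.univ.filter fun k => s ∣ lam k).card ∧
      (Finset.univ.filter fun k => s ∣ lam k).card ≤ omegaQ m s + 4 := by
    obtain ⟨l, a, hl, ha, rfl⟩ := (isPrimePow_nat_iff s).mp hs
    obtain ⟨a, rfl⟩ : ∃ b, a = b + 1 := ⟨a - 1, by lia⟩
    have ht := torsionCard_invariant_factors hl a h1 e
    have hT := torsionCard_pos (l ^ a) (ZMod m)ˣ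
    have hlow := pow_omegaQ_mul_torsionCard_le hl a hm0
    have hup := torsionCard_le_pow_omegaQ_mul hl a hm0
    rw [ht] at hlow hup
    exact ⟨(Nat.pow_le_pow_iff_right hl.one_lt).mp (Nat.le_of_mul_le_mul_right hlow hT),
      (Nat.pow_le_pow_iff_right hl.one_lt).mp (Nat.le_of_mul_le_mul_right hup hT)⟩
  have := (key hq).1
  have := (key hr).2
  lia

lemma IsPrimePow.le_two_mul_totient {q : ℕ} (hq : IsPrimePow q) : q ≤ 2 * q.totient := by
  obtain ⟨p, k, hp, hk, rfl⟩ := (isPrimePow_nat_iff q).mp hq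
  obtain ⟨k, rfl⟩ := Nat.exists_eq_add_of_lt hk
  rw [zero_add, Nat.totient_prime_pow_succ hp, pow_succ, mul_left_comm]
  have := hp.two_le
  exact Nat.mul_le_mul_left _ (by lia)

lemma ppKey_lt_of_totient_lt {q r : ℕ} (hq : IsPrimePow q) (h : q.totient < r.totient) :
    ppKey q < ppKey r := by
  have := hq.le_two_mul_totient
  unfold ppKey
  nlinarith

lemma totient_le_of_ppKey_le {q r : ℕ} (hr : IsPrimePow r) (h : ppKey q ≤ ppKey r) :
    q.totient ≤ r.totient :=
  not_lt.mp fun hlt => (ppKey_lt_of_totient_lt hr hlt).not_ge h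

lemma ppKey_inj {q r : ℕ} (hq : IsPrimePow q) (hr : IsPrimePow r) (h : ppKey q = ppKey r) :
    q = r := by
  have := (totient_le_of_ppKey_le hr h.le).antisymm (totient_le_of_ppKey_le hq h.ge)
  unfold ppKey at h
  rw [this] at h
  lia

lemma infinite_ppKey : (Set.ofPred fun k => ∃ q : ℕ, IsPrimePow q ∧ ppKey q = k).Infinite := by
  refine Set.infinite_of_forall_exists_gt fun n => ?_
  obtain ⟨p, hnp, hp⟩ := Nat.exists_infinite_primes (n + 1)
  exact ⟨ppKey p, ⟨p, hp.isPrimePow, rfl⟩, by unfold ppKey; lia⟩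

lemma qt_spec (i : ℕ) : IsPrimePow (qt i) ∧ ppKey (qt i) = ppNthKey (i - 1) :=
  Nat.sInf_mem (s := {q : ℕ | IsPrimePow q ∧ ppKey q = ppNthKey (i - 1)})
    (Nat.nth_mem_of_infinite infinite_ppKey (i - 1))

lemma exists_qt_eq {q : ℕ} (hq : IsPrimePow q) : ∃ i, 1 ≤ i ∧ qt i = q := by
  classical
  refine ⟨Nat.count (fun k => ∃ q : ℕ, IsPrimePow q ∧ ppKey q = k) (ppKey q) + 1, by lia, ?_⟩
  have h := qt_spec (Nat.count (fun k => ∃ q : ℕ, IsPrimePow q ∧ ppKey q = k) (ppKey q) + 1)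
  refine ppKey_inj h.1 hq (h.2.trans ?_)
  exact Nat.nth_count (p := fun k => ∃ q : ℕ, IsPrimePow q ∧ ppKey q = k) ⟨q, hq, rfl⟩

lemma ppKey_qt_lt_iff {i j : ℕ} (hi : 1 ≤ i) (hj : 1 ≤ j) :
    ppKey (qt i) < ppKey (qt j) ↔ i < j := by
  rw [(qt_spec i).2, (qt_spec j).2, ppNthKey, ppNthKey,
    (Nat.nth_strictMono infinite_ppKey).lt_iff_lt]
  lia

lemma ppKey_qt_le_iff {i j : ℕ} (hi : 1 ≤ i) (hj : 1 ≤ j) :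
    ppKey (qt i) ≤ ppKey (qt j) ↔ i ≤ j := by
  rw [← not_lt, ppKey_qt_lt_iff hj hi, not_lt]

lemma totient_prime_pow_ne_of_lt {p r : ℕ} (hp : p.Prime) (hr : r.Prime) (h : p < r) (a b : ℕ) :
    (p ^ (a + 2)).totient ≠ (r ^ (b + 2)).totient := by
  intro he
  rw [Nat.totient_prime_pow_succ hp, Nat.totient_prime_pow_succ hr] at he
  have hd : r ∣ p ^ (a + 1) * (p - 1) := he ▸ Dvd.dvd.mul_right (dvd_pow_self r (by lia)) _
  have := hp.two_le
  rcases hr.dvd_mul.mp hd with hd | hd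
  · exact absurd (Nat.le_of_dvd hp.pos (hr.dvd_of_dvd_pow hd)) (by lia)
  · exact absurd (Nat.le_of_dvd (by lia) hd) (by lia)

lemma eq_of_totient_eq_of_not_prime {x y : ℕ} (hx : IsPrimePow x) (hy : IsPrimePow y)
    (hx' : ¬ x.Prime) (hy' : ¬ y.Prime) (h : x.totient = y.totient) : x = y := by
  have aux {z : ℕ} (hz : IsPrimePow z) (hz' : ¬ z.Prime) : ∃ p a, p.Prime ∧ z = p ^ (a + 2) := by
    obtain ⟨p, k, hp, hk, rfl⟩ := (isPrimePow_nat_iff z).mp hz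
    have : k ≠ 1 := by rintro rfl; exact hz' (by simpa using hp)
    exact ⟨p, k - 2, hp, by congr 1; lia⟩
  obtain ⟨p, a, hp, rfl⟩ := aux hx hx'
  obtain ⟨r, b, hr, rfl⟩ := aux hy hy'
  rcases lt_trichotomy p r with hpr | rfl | hpr
  · exact absurd h (totient_prime_pow_ne_of_lt hp hr hpr a b)
  · rw [Nat.totient_prime_pow_succ hp, Nat.totient_prime_pow_succ hp] at h
    have := hp.two_le
    have h' := Nat.eq_of_mul_eq_mul_right (by lia) h
    rw [pow_succ, h', ← pow_succ]
  · exact absurd h.symm (totient_prime_pow_ne_of_lt hr hp hpr b a)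

/-- At most two prime powers share a given totient. -/
lemma eq_or_eq_of_totient_eq {x y z : ℕ} (hx : IsPrimePow x) (hy : IsPrimePow y)
    (hz : IsPrimePow z) (hxy : x.totient = y.totient) (hzy : z.totient = y.totient)
    (hne : x ≠ y) : z = x ∨ z = y := by
  have hpp {u v : ℕ} (hu : u.Prime) (hv : v.Prime) (h : u.totient = v.totient) : u = v := by
    rw [Nat.totient_prime hu, Nat.totient_prime hv] at h
    have := hu.two_le
    have := hv.two_le
    lia
  have hnn {u v : ℕ} (hu : IsPrimePow u) (hv : IsPrimePow v) (h : u.totient = v.totient)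
      (hu' : ¬ u.Prime) (hv' : ¬ v.Prime) : u = v :=
    eq_of_totient_eq_of_not_prime hu hv hu' hv' h
  by_cases h1 : x.Prime <;> by_cases h2 : y.Prime <;> by_cases h3 : z.Prime
  · exact absurd (hpp h1 h2 hxy) hne
  · exact absurd (hpp h1 h2 hxy) hne
  · exact Or.inl (hpp h3 h1 (hzy.trans hxy.symm))
  · exact Or.inr (hnn hz hy hzy h3 h2)
  · exact Or.inr (hpp h3 h2 hzy)
  · exact Or.inl (hnn hz hx (hzy.trans hxy.symm) h3 h1)
  · exact absurd (hnn hx hy hxy h1 h2) hne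
  · exact absurd (hnn hx hy hxy h1 h2) hne

lemma dvd_of_forall_isPrimePow_dvd {d n : ℕ} (h : ∀ r, IsPrimePow r → r ∣ d → r ∣ n) : d ∣ n := by
  rw [Nat.dvd_iff_prime_pow_dvd_dvd]
  intro p k hp hd
  rcases k.eq_zero_or_pos with rfl | hk
  · simp
  · exact h _ (hp.isPrimePow.pow hk.ne') hd

/-- If the prime powers dividing `d` form an initial segment with respect to the totient, then `d`
is a universal factor order. -/
lemma exists_mem_UFO {d : ℕ} (hd : 2 ≤ d) (H : ∀ q r : ℕ, IsPrimePow q → IsPrimePow r → r ∣ d →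
    q.totient < r.totient → q ∣ d) : ∃ i, 1 ≤ i ∧ d ∈ UFO i := by
  classical
  have hne : (d.divisors.filter IsPrimePow).Nonempty :=
    ⟨d.minFac, by
      simpa [Nat.minFac_dvd, (show d ≠ 0 by lia)] using
        (Nat.minFac_prime (show d ≠ 1 by lia)).isPrimePow⟩
  obtain ⟨s, hs, hmax⟩ := Finset.exists_max_image _ ppKey hne
  simp only [Finset.mem_filter, Nat.mem_divisors] at hs hmax
  obtain ⟨⟨hsd, hd0⟩, hspp⟩ := hs
  replace hmax (r : ℕ) (hr : IsPrimePow r) (hrd : r ∣ d) : ppKey r ≤ ppKey s :=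
    hmax r ⟨⟨hrd, hd0⟩, hr⟩
  obtain ⟨i, hi, rfl⟩ := exists_qt_eq hspp
  by_cases hall : ∀ q, IsPrimePow q → ppKey q ≤ ppKey (qt i) → q ∣ d
  · have hdL : d = Lseq i := by
      apply Nat.dvd_antisymm
      · refine dvd_of_forall_isPrimePow_dvd fun r hr hrd => ?_
        obtain ⟨k, hk, rfl⟩ := exists_qt_eq hr
        exact Finset.dvd_lcm (Finset.mem_Icc.mpr ⟨hk, (ppKey_qt_le_iff hk hi).mp (hmax _ hr hrd)⟩)
      · refine Finset.lcm_dvd fun k hk => ?_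
        rw [Finset.mem_Icc] at hk
        exact hall _ (qt_spec k).1 ((ppKey_qt_le_iff hk.1 hi).mpr hk.2)
    refine ⟨i, hi, ?_⟩
    unfold UFO
    split_ifs <;> simp [hdL]
  · push Not at hall
    obtain ⟨q, hq, hqs, hqd⟩ := hall
    have hphi : q.totient = (qt i).totient :=
      (totient_le_of_ppKey_le hspp hqs).antisymm (not_lt.mp fun h => hqd (H _ _ hq hspp hsd h))
    have hqne : q ≠ qt i := by rintro rfl; exact hqd hsd
    obtain ⟨j, hj, rfl⟩ := exists_qt_eq hq
    have hji : j < i := by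
      refine lt_of_le_of_ne ((ppKey_qt_le_iff hj hi).mp hqs) ?_
      rintro rfl
      exact hqne rfl
    have htwo (k : ℕ) (hk : 1 ≤ k) (h : (qt k).totient = (qt i).totient) : k = j ∨ k = i := by
      rcases eq_or_eq_of_totient_eq hq hspp (qt_spec k).1 hphi h hqne with h | h
      · exact Or.inl (le_antisymm ((ppKey_qt_le_iff hk hj).mp (by rw [h]))
          ((ppKey_qt_le_iff hj hk).mp (by rw [h])))
      · exact Or.inr (le_antisymm ((ppKey_qt_le_iff hk hi).mp (by rw [h]))
          ((ppKey_qt_le_iff hi hk).mp (by rw [h])))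
    have hle (k : ℕ) (hk : 1 ≤ k) (h : k ≤ i) : (qt k).totient ≤ (qt i).totient :=
      totient_le_of_ppKey_le hspp ((ppKey_qt_le_iff hk hi).mpr h)
    have hsucc : i = j + 1 := by
      have h1 : (qt j).totient ≤ (qt (j + 1)).totient :=
        totient_le_of_ppKey_le (qt_spec _).1 ((ppKey_qt_le_iff hj (by lia)).mpr (by lia))
      rcases htwo (j + 1) (by lia) ((hle _ (by lia) hji).antisymm (hphi ▸ h1)) <;> lia
    subst hsucc
    refine ⟨j, hj, ?_⟩
    unfold UFO
    rw [if_neg (by rw [hphi]; exact lt_irrefl _)]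
    right
    apply Nat.dvd_antisymm
    · refine dvd_of_forall_isPrimePow_dvd fun r hr hrd => ?_
      obtain ⟨k, hk, rfl⟩ := exists_qt_eq hr
      have hkj := (ppKey_qt_le_iff hk hi).mp (hmax _ hr hrd)
      have hkne : k ≠ j := by rintro rfl; exact hqd hrd
      rcases eq_or_ne k (j + 1) with rfl | hk1
      · exact Nat.dvd_lcm_right _ _
      · exact (Finset.dvd_lcm (f := qt) (Finset.mem_Icc.mpr ⟨hk, by lia⟩)).trans
          (Nat.dvd_lcm_left _ _)
    · refine Nat.lcm_dvd (Finset.lcm_dvd fun k hk => ?_) hsd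
      rw [Finset.mem_Icc] at hk
      refine H _ _ (qt_spec k).1 hspp hsd (lt_of_le_of_ne (hle k hk.1 (by lia)) fun h => ?_)
      rcases htwo k hk.1 h <;> lia

lemma sum_primeInd_dvd (q z : ℕ) {m : ℕ} (hm : m ≠ 0) :
    ∑ p ∈ (Finset.range (z + 1)).filter Nat.Prime, primeInd q p * (if p ∣ m then (1 : ℝ) else 0) =
      ((m.primeFactors.filter fun p => p % q = 1 % q).filter (· ≤ z)).card := by
  have h : ∀ p ∈ (Finset.range (z + 1)).filter Nat.Prime,
      primeInd q p * (if p ∣ m then (1 : ℝ) else 0) =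
        if p % q = 1 % q ∧ p ∣ m then 1 else 0 := by
    intro p hp
    have hp' := (Finset.mem_filter.mp hp).2
    have hiff : (p : ZMod q) = 1 ↔ p % q = 1 % q := by
      rw [← ZMod.natCast_eq_natCast_iff', Nat.cast_one]
    simp only [primeInd, hiff, hp', true_and]
    split_ifs <;> simp_all
  rw [Finset.sum_congr rfl h, Finset.sum_boole]
  congr 2
  ext p
  simp only [Finset.mem_filter, Finset.mem_range, Nat.mem_primeFactors, Nat.lt_succ_iff]
  tauto

lemma sum_primeInd_dvd_le_omegaQ (q z : ℕ) {m : ℕ} (hm : m ≠ 0) :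
    ∑ p ∈ (Finset.range (z + 1)).filter Nat.Prime, primeInd q p * (if p ∣ m then (1 : ℝ) else 0) ≤
      omegaQ m q := by
  rw [sum_primeInd_dvd q z hm]
  exact_mod_cast Finset.card_filter_le _ _

/-- At most one prime factor of `m` exceeds the square root of `m`. -/
lemma omegaQ_le_sum_primeInd_dvd_add_one (q : ℕ) {z m : ℕ} (hm : m ≠ 0)
    (hz : m < (z + 1) * (z + 1)) :
    (omegaQ m q : ℝ) ≤ ∑ p ∈ (Finset.range (z + 1)).filter Nat.Prime,
      primeInd q p * (if p ∣ m then (1 : ℝ) else 0) + 1 := by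
  rw [sum_primeInd_dvd q z hm]
  have h1 : ((m.primeFactors.filter fun p => p % q = 1 % q).filter (¬ · ≤ z)).card ≤ 1 := by
    rw [Finset.card_le_one]
    intro a ha b hb
    simp only [Finset.mem_filter, Nat.mem_primeFactors, not_le] at ha hb
    by_contra hab
    have hdvd := ((Nat.coprime_primes ha.1.1.1 hb.1.1.1).mpr hab).mul_dvd_of_dvd_of_dvd
      ha.1.1.2.1 hb.1.1.2.1
    have := Nat.le_of_dvd (Nat.pos_of_ne_zero hm) hdvd
    have := Nat.mul_le_mul (show z + 1 ≤ a from ha.2) (show z + 1 ≤ b from hb.2)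
    omega
  have h2 := Finset.card_filter_add_card_filter_not (s := m.primeFactors.filter
    fun p => p % q = 1 % q) (· ≤ z)
  rw [omegaQ]
  exact_mod_cast (by omega)

lemma sum_primeInd_div (q z : ℕ) :
    ∑ p ∈ (Finset.range (z + 1)).filter Nat.Prime, primeInd q p / p = primeRecip q z := by
  refine Finset.sum_filter_of_ne fun p _ hp => ?_
  by_contra h
  exact hp (by simp [primeInd, h])

lemma card_primes_range_le (z : ℕ) : ((Finset.range (z + 1)).filter Nat.Prime).card ≤ z := by
  calc ((Finset.range (z + 1)).filter Nat.Prime).card ≤ (Finset.Icc 1 z).card := by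
        refine Finset.card_le_card fun p hp => ?_
        simp only [Finset.mem_filter, Finset.mem_range] at hp
        exact Finset.mem_Icc.mpr ⟨hp.2.one_le, by omega⟩
    _ = z := by simp

lemma card_omegaQ_lt_mul_sq_le (q r n : ℕ)
    (h : 5 < primeRecip q n.sqrt - primeRecip r n.sqrt) :
    (((Finset.Icc 1 n).filter fun m => omegaQ m q < omegaQ m r + 4).card : ℝ) *
      (primeRecip q n.sqrt - primeRecip r n.sqrt - 5) ^ 2 ≤
      n * (primeRecip q n.sqrt + primeRecip r n.sqrt + 2) := by
  set z := n.sqrt with hz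
  set S := (Finset.range (z + 1)).filter Nat.Prime with hS
  set w : ℕ → ℝ := fun p => primeInd q p - primeInd r p with hw
  have hw1 : ∀ p, |w p| ≤ 1 := fun p => abs_sub_le_iff.mpr
    ⟨by linarith [primeInd_le_one q p, primeInd_nonneg r p],
      by linarith [primeInd_le_one r p, primeInd_nonneg q p]⟩
  have hw2 : ∑ p ∈ S, |w p| / p ≤ primeRecip q z + primeRecip r z := by
    rw [← sum_primeInd_div, ← sum_primeInd_div, ← Finset.sum_add_distrib]
    refine Finset.sum_le_sum fun p _ => ?_
    rw [← add_div]
    gcongr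
    exact abs_sub_le_iff.mpr ⟨by linarith [primeInd_nonneg r p], by linarith [primeInd_nonneg q p]⟩
  have hturan := sum_sq_sub_le n S (fun p hp => (Finset.mem_filter.mp hp).2) w hw1
  have hcard : (S.card : ℝ) ^ 2 ≤ n := by
    have h1 : S.card ^ 2 ≤ z ^ 2 := Nat.pow_le_pow_left (card_primes_range_le z) 2
    exact_mod_cast h1.trans (Nat.sqrt_le' n)
  have hdev : ∀ m ∈ (Finset.Icc 1 n).filter fun m => omegaQ m q < omegaQ m r + 4,
      (primeRecip q z - primeRecip r z - 5) ^ 2 ≤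
        (∑ p ∈ S, w p * ((if p ∣ m then (1 : ℝ) else 0) - 1 / p)) ^ 2 := by
    intro m hm
    obtain ⟨hm, hlt⟩ := Finset.mem_filter.mp hm
    obtain ⟨hm1, hmn⟩ := Finset.mem_Icc.mp hm
    have hq := sum_primeInd_dvd_le_omegaQ q z (m := m) (by omega)
    have hr := omegaQ_le_sum_primeInd_dvd_add_one r (z := z) (m := m) (by omega)
      (hmn.trans_lt (Nat.lt_succ_sqrt n))
    have hlt' : (omegaQ m q : ℝ) < omegaQ m r + 4 := by exact_mod_cast hlt
    have hsum : ∑ p ∈ S, w p * ((if p ∣ m then (1 : ℝ) else 0) - 1 / p) =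
        (∑ p ∈ S, primeInd q p * (if p ∣ m then (1 : ℝ) else 0)) -
        (∑ p ∈ S, primeInd r p * (if p ∣ m then (1 : ℝ) else 0)) -
        (primeRecip q z - primeRecip r z) := by
      rw [← sum_primeInd_div, ← sum_primeInd_div, ← Finset.sum_sub_distrib,
        ← Finset.sum_sub_distrib, ← Finset.sum_sub_distrib]
      exact Finset.sum_congr rfl fun p _ => by rw [hw]; ring
    rw [hsum, sq_le_sq, abs_of_pos (by linarith)]
    exact le_trans (by linarith) (neg_le_abs _)
  calc _ = ∑ m ∈ (Finset.Icc 1 n).filter fun m => omegaQ m q < omegaQ m r + 4,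
        (primeRecip q z - primeRecip r z - 5) ^ 2 := by rw [Finset.sum_const, nsmul_eq_mul]
    _ ≤ _ := Finset.sum_le_sum hdev
    _ ≤ _ := Finset.sum_le_sum_of_subset_of_nonneg (Finset.filter_subset _ _)
        fun _ _ _ => sq_nonneg _
    _ ≤ _ := hturan
    _ ≤ n * (primeRecip q z + primeRecip r z) + 2 * n := by gcongr
    _ = _ := by ring

lemma tendsto_card_omegaQ_lt_div {q r : ℕ} (hq : 0 < q) (hqr : q.totient < r.totient) :
    Tendsto (fun n : ℕ =>
      (((Finset.Icc 1 n).filter fun m => omegaQ m q < omegaQ m r + 4).card : ℝ) / n)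
      atTop (nhds 0) := by
  have hr : 0 < r := Nat.totient_pos.mp (hqr.pos)
  have : NeZero q := ⟨hq.ne'⟩
  have : NeZero r := ⟨hr.ne'⟩
  have hsqrt : Tendsto Nat.sqrt atTop atTop :=
    tendsto_atTop_atTop.mpr fun b => ⟨b * b, fun a ha => Nat.le_sqrt.mpr ha⟩
  have hL := tendsto_log_log_atTop.comp hsqrt
  have hQ := (tendsto_primeRecip_div_log_log q).comp hsqrt
  have hR := (tendsto_primeRecip_div_log_log r).comp hsqrt
  have hinv := hL.inv_tendsto_atTop
  simp only [Function.comp_def] at hL hQ hR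
  have hpos : 0 < (q.totient : ℝ)⁻¹ - (r.totient : ℝ)⁻¹ := by
    have : (0 : ℝ) < q.totient := by exact_mod_cast Nat.totient_pos.mpr hq
    exact sub_pos.mpr (inv_strictAnti₀ this (by exact_mod_cast hqr))
  set L : ℕ → ℝ := fun n => Real.log (Real.log n.sqrt) with hLdef
  have hinv' : Tendsto (fun n => (L n)⁻¹) atTop (nhds 0) := hL.inv_tendsto_atTop
  have hnum := (hQ.add hR).add (hinv'.const_mul 2)
  have hden := ((hQ.sub hR).sub (hinv'.const_mul 5))
  rw [mul_zero, sub_zero] at hden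
  have hmain := hinv'.mul (hnum.div (hden.pow 2) (pow_ne_zero 2 hpos.ne'))
  rw [zero_mul] at hmain
  have hgap : ∀ᶠ n : ℕ in atTop, 5 < primeRecip q n.sqrt - primeRecip r n.sqrt := by
    filter_upwards [hden.eventually (lt_mem_nhds hpos), hL.eventually_gt_atTop 0] with n h1 h2
    have : 0 < (primeRecip q n.sqrt - primeRecip r n.sqrt - 5) / L n := by
      have e : (primeRecip q n.sqrt - primeRecip r n.sqrt - 5) / L n =
        primeRecip q n.sqrt / L n - primeRecip r n.sqrt / L n - 5 * (L n)⁻¹ := by ring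
      exact e ▸ h1
    linarith [(div_pos_iff_of_pos_right h2).mp this]
  refine squeeze_zero' (.of_forall fun n => by positivity) ?_ hmain
  filter_upwards [hgap, hL.eventually_gt_atTop 0, eventually_gt_atTop 0] with n h1 h2 h3
  have hn : (0 : ℝ) < n := by exact_mod_cast h3
  have hb := card_omegaQ_lt_mul_sq_le q r n h1
  have h5 : 0 < primeRecip q n.sqrt - primeRecip r n.sqrt - 5 := by linarith
  have heq : (L n)⁻¹ * ((primeRecip q n.sqrt / L n + primeRecip r n.sqrt / L n + 2 * (L n)⁻¹) /
      (primeRecip q n.sqrt / L n - primeRecip r n.sqrt / L n - 5 * (L n)⁻¹) ^ 2) =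
      (primeRecip q n.sqrt + primeRecip r n.sqrt + 2) /
        (primeRecip q n.sqrt - primeRecip r n.sqrt - 5) ^ 2 := by
    have e1 : primeRecip q n.sqrt / L n + primeRecip r n.sqrt / L n + 2 * (L n)⁻¹ =
      (primeRecip q n.sqrt + primeRecip r n.sqrt + 2) / L n := by ring
    have e2 : primeRecip q n.sqrt / L n - primeRecip r n.sqrt / L n - 5 * (L n)⁻¹ =
      (primeRecip q n.sqrt - primeRecip r n.sqrt - 5) / L n := by ring
    rw [e1, e2]
    field_simp
  refine le_trans ?_ heq.ge
  rw [div_le_div_iff₀ hn (by positivity)]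
  linarith

theorem statement14 (d : ℕ) (hd2 : 2 ≤ d) (hrare : ∀ i : ℕ, 1 ≤ i → d ∉ UFO i)
    (J : ℕ → ℕ) (hJ : IsInvCount d J) :
    Filter.Tendsto (fun n : ℕ => ((cnt (fun m => 0 < J m) n : ℝ)) / n)
      Filter.atTop (nhds 0) := by
  obtain ⟨q, r, hq, hr, hrd, hqr, hqd⟩ : ∃ q r : ℕ, IsPrimePow q ∧ IsPrimePow r ∧ r ∣ d ∧
      q.totient < r.totient ∧ ¬ q ∣ d := by
    by_contra! H
    obtain ⟨i, hi, hdi⟩ := exists_mem_UFO hd2 H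
    exact hrare i hi hdi
  refine squeeze_zero (fun n => by positivity) (fun n => ?_)
    (tendsto_card_omegaQ_lt_div hq.pos hqr)
  gcongr
  rw [cnt, ← Set.ncard_coe_finset]
  refine Set.ncard_le_ncard (fun m hm => ?_) (Finset.finite_toSet _)
  obtain ⟨hm1, hmn, hpos⟩ := hm
  exact Finset.mem_coe.mpr (Finset.mem_filter.mpr ⟨Finset.mem_Icc.mpr ⟨hm1, hmn⟩,
    omegaQ_lt_of_invCount_pos hJ hq hr hqd hrd hm1 hpos⟩)

end
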